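/- Let R = k[x_0,...,x_n] with char k = p > 0 and I generated by d-forms with c = fpt(I). Suppose (R, I^c) is sharply F-pure and c = h/d where h = height(τ(R, I^c)). Then there exist linear forms ℓ_1,...,ℓ_h such that τ(R, I^c) = (ℓ_1,...,ℓ_h); in particular, the test ideal at the threshold is a prime ideal generated by linear forms. -/

import Mathlib

open MvPolynomial Filter

noncomputable section

variable {k : Type*} [Field k]

/-- The `q`-th bracket power of an ideal. -/
def frobPow {R : Type*} [CommRing R] (q : ℕ) (I : Ideal R) : Ideal R :=
  Ideal.span ((fun x => x ^ q) '' (I : Set R))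

/-- The homogeneous maximal ideal of `k[x_0,…,x_n]`. -/
def maxIdl (n : ℕ) (k : Type*) [Field k] : Ideal (MvPolynomial (Fin (n + 1)) k) :=
  Ideal.span (Set.range X)

/-- `ν_I(q) = max{r : I^r ⊄ 𝔪^{[q]}}`. -/
def nuFn {n : ℕ} (I : Ideal (MvPolynomial (Fin (n + 1)) k)) (q : ℕ) : ℕ :=
  sSup {r : ℕ | ¬ I ^ r ≤ frobPow q (maxIdl n k)}

/-- The height of an ideal. -/
def idealHeight {R : Type*} [CommRing R] (I : Ideal R) : ℕ∞ :=
  ⨅ (p : PrimeSpectrum R) (_ : I ≤ p.asIdeal), Order.height p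

/-- The `q`-th Frobenius root `J^{[1/q]}`: the smallest ideal whose `q`-th bracket power
contains `J`. -/
def frobRoot {R : Type*} [CommRing R] (q : ℕ) (J : Ideal R) : Ideal R :=
  sInf {K : Ideal R | J ≤ frobPow q K}

/-- The test ideal `τ(R, I^c)` of a pair over a polynomial ring, via the
Blickle–Mustață–Smith description `τ(I^c) = ⋃_e (I^{⌈c p^e⌉})^{[1/p^e]}`. -/
def testIdeal {R : Type*} [CommRing R] (p : ℕ) (c : ℝ) (I : Ideal R) : Ideal R :=
  ⨆ e : ℕ, frobRoot (p ^ e) (I ^ ⌈c * (p : ℝ) ^ e⌉₊)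

/-- The pair `(R, I^t)` is sharply `F`-pure: for infinitely many `e > 0` the evaluation
map `I^{⌈t(p^e−1)⌉}·Hom(F^e_*R, R) → R` is surjective. -/
def SharplyFPurePair {R : Type*} [CommRing R] (p : ℕ) (I : Ideal R) (t : ℝ) : Prop :=
  ∃ᶠ e : ℕ in atTop, 0 < e ∧
    Ideal.span {y : R | ∃ (φ : R →+ R) (a : R),
      (∀ r x : R, φ (r ^ p ^ e * x) = r * φ x) ∧
      a ∈ I ^ ⌈t * ((p : ℝ) ^ e - 1)⌉₊ ∧ y = φ a} = ⊤



namespace Stmt19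

open Classical in
/-- The `q⁻¹`-linear map attached to an additive map on coefficients and a residue exponent. -/
def cart {σ : Type*} {F : Type*} [Field F] (q : ℕ) (ψ : F →+ F) (u : σ →₀ ℕ) :
    MvPolynomial σ F →+ MvPolynomial σ F :=
  (Finsupp.liftAddHom (fun s : σ →₀ ℕ =>
    if s.mapRange (· % q) (Nat.zero_mod q) = u then
      ((monomial (s.mapRange (· / q) (Nat.zero_div q)) : F →ₗ[F] MvPolynomial σ F).toAddMonoidHom.comp ψ)
    else 0)).comp
    ((basisMonomials σ F).repr : MvPolynomial σ F ≃ₗ[F] _).toLinearMap.toAddMonoidHom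

open Classical in
lemma cart_monomial {σ : Type*} {F : Type*} [Field F] (q : ℕ) (ψ : F →+ F) (u : σ →₀ ℕ)
    (s : σ →₀ ℕ) (a : F) :
    cart q ψ u (monomial s a) =
      if s.mapRange (· % q) (Nat.zero_mod q) = u then
        monomial (s.mapRange (· / q) (Nat.zero_div q)) (ψ a) else 0 := by
  have : (basisMonomials σ F).repr (monomial s a) = Finsupp.single s a := by
    have h : monomial s a = a • (basisMonomials σ F) s := by
      simp [smul_monomial]
    rw [h, map_smul, Module.Basis.repr_self]; simp
  unfold cart
  simp only [AddMonoidHom.comp_apply, LinearMap.toAddMonoidHom_coe, LinearEquiv.coe_coe, this,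
    Finsupp.liftAddHom_apply_single]
  split_ifs <;> simp

lemma cart_lin {σ : Type*} {F : Type*} [Field F] {p : ℕ} (hp : p.Prime) [CharP F p] (e : ℕ)
    (ψ : F →+ F) (hψ : ∀ r x : F, ψ (r ^ p ^ e * x) = r * ψ x) (u : σ →₀ ℕ)
    (r x : MvPolynomial σ F) :
    cart (p ^ e) ψ u (r ^ p ^ e * x) = r * cart (p ^ e) ψ u x := by
  have := Fact.mk hp
  induction r using MvPolynomial.induction_on' with
  | add a b ha hb => rw [add_pow_char_pow, add_mul, map_add, ha, hb, add_mul]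
  | monomial t c =>
    induction x using MvPolynomial.induction_on' with
    | add a b ha hb => rw [mul_add, map_add, ha, hb, map_add, mul_add]
    | monomial s a =>
      rw [monomial_pow, monomial_mul, cart_monomial, cart_monomial, hψ]
      have hq : 0 < p ^ e := pow_pos hp.pos e
      have h1 : (p ^ e • t + s).mapRange (· % p ^ e) (Nat.zero_mod _) =
          s.mapRange (· % p ^ e) (Nat.zero_mod _) := by
        ext i; simp
      have h2 : (p ^ e • t + s).mapRange (· / p ^ e) (Nat.zero_div _) =
          t + s.mapRange (· / p ^ e) (Nat.zero_div _) := by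
        ext i; simp [Nat.mul_add_div hq]
      rw [h1, h2]
      split_ifs
      · rw [monomial_mul]
      · simp


/-- A dual basis for a field over a field mapping to it. -/
lemma field_dual {F E : Type*} [Field F] [Field E] (θ : F →+* E) (A : Finset E) :
    ∃ (T : Finset E) (ψ : E → (E →+ F)), (∀ b, ∀ (r : F) (x : E), ψ b (θ r * x) = r * ψ b x) ∧
      ∀ a ∈ A, ∑ b ∈ T, θ (ψ b a) * b = a := by
  classical
  let _ : Algebra F E := θ.toAlgebra
  have hsm : ∀ (r : F) (x : E), r • x = θ r * x := fun r x => rfl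
  let B := Module.Basis.ofVectorSpace F E
  let T : Finset (Module.Basis.ofVectorSpaceIndex F E) := A.biUnion (fun a => (B.repr a).support)
  have inj : Function.Injective B := B.injective
  have : Nonempty (Module.Basis.ofVectorSpaceIndex F E) := B.index_nonempty
  refine ⟨T.image B, fun b => (B.coord (Function.invFun B b)).toAddMonoidHom, ?_, ?_⟩
  · intro b r x
    simp [← hsm]
  · intro a ha
    rw [Finset.sum_image (fun x _ y _ h => inj h)]
    simp only [Function.leftInverse_invFun inj _, LinearMap.toAddMonoidHom_coe, ← hsm,
      Module.Basis.coord_apply]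
    conv_rhs => rw [← B.linearCombination_repr a]
    rw [Finsupp.linearCombination_apply, Finsupp.sum]
    symm
    apply Finset.sum_subset
    · exact Finset.subset_biUnion_of_mem (fun a => (B.repr a).support) ha
    · intro x _ hx
      simp [Finsupp.notMem_support_iff.mp hx]

/-- Dual basis for the polynomial ring over itself via the iterated Frobenius. -/
lemma poly_dual {σ : Type*} [Fintype σ] {F : Type*} [Field F] {p : ℕ} (hp : p.Prime) [CharP F p]
    (e : ℕ) (g : MvPolynomial σ F) :
    ∃ (T : Finset (F × (σ → Fin (p ^ e)))) (φ : (F × (σ → Fin (p ^ e))) →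
        (MvPolynomial σ F →+ MvPolynomial σ F)) (b : (F × (σ → Fin (p ^ e))) → MvPolynomial σ F),
      (∀ i, ∀ r x, φ i (r ^ p ^ e * x) = r * φ i x) ∧
      (∑ i ∈ T, (φ i g) ^ p ^ e * b i = g) ∧
      ∀ D, g.IsHomogeneous D → ∀ i, ∃ D', (φ i g).IsHomogeneous D' := by
  classical
  have := Fact.mk hp
  have hq : 0 < p ^ e := pow_pos hp.pos e
  obtain ⟨T, ψ, hψ, hT⟩ := field_dual (iterateFrobenius F p e) (g.support.image (fun s => coeff s g))
  simp only [iterateFrobenius_def] at hψ hT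
  let ex : (σ → Fin (p ^ e)) → (σ →₀ ℕ) := fun u => Finsupp.equivFunOnFinite.symm (fun i => (u i : ℕ))
  refine ⟨T ×ˢ Finset.univ, fun i => cart (p ^ e) (ψ i.1) (ex i.2),
    fun i => monomial (ex i.2) i.1, ?_, ?_, ?_⟩
  · intro i r x
    exact cart_lin hp e _ (hψ _) _ r x
  · let G : MvPolynomial σ F →+ MvPolynomial σ F :=
      ∑ i ∈ T ×ˢ (Finset.univ : Finset (σ → Fin (p ^ e))),
        (AddMonoidHom.mulRight (monomial (ex i.2) i.1)).comp
          ((iterateFrobenius (MvPolynomial σ F) p e).toAddMonoidHom.comp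
            (cart (p ^ e) (ψ i.1) (ex i.2)))
    have hG : ∀ x, G x = ∑ i ∈ T ×ˢ (Finset.univ : Finset (σ → Fin (p ^ e))),
        (cart (p ^ e) (ψ i.1) (ex i.2) x) ^ p ^ e * monomial (ex i.2) i.1 := by
      intro x
      simp only [G, AddMonoidHom.finsetSum_apply]
      rfl
    rw [← hG]
    conv_rhs => rw [g.as_sum]
    conv_lhs => rw [g.as_sum]
    rw [map_sum]
    apply Finset.sum_congr rfl
    intro s hs
    rw [hG, Finset.sum_product]
    let u0 : σ → Fin (p ^ e) := fun i => ⟨s i % p ^ e, Nat.mod_lt _ hq⟩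
    have hu0 : ex u0 = s.mapRange (· % p ^ e) (Nat.zero_mod _) := by
      ext i; simp [ex, u0]
    have hinj : Function.Injective ex := by
      intro u v h
      ext i
      have := DFunLike.congr_fun h i
      simpa [ex] using this
    have hstep : ∀ b ∈ T, (∑ u : σ → Fin (p ^ e),
        (cart (p ^ e) (ψ b) (ex u) (monomial s (coeff s g))) ^ p ^ e * monomial (ex u) b) =
        monomial s ((ψ b (coeff s g)) ^ p ^ e * b) := by
      intro b _
      rw [Finset.sum_eq_single u0]
      · rw [cart_monomial, if_pos hu0.symm, monomial_pow, monomial_mul]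
        have hs' : p ^ e • s.mapRange (· / p ^ e) (Nat.zero_div _) + ex u0 = s := by
          rw [hu0]; ext i; simp [Nat.div_add_mod]
        rw [hs']
      · intro u _ hu
        rw [cart_monomial, if_neg, zero_pow hq.ne', zero_mul]
        intro h
        exact hu (hinj (h.symm.trans hu0.symm))
      · simp
    rw [Finset.sum_congr rfl hstep, ← map_sum, hT _ (Finset.mem_image_of_mem _ hs)]
  · intro D hD i
    refine ⟨(D - (ex i.2).degree) / p ^ e, ?_⟩
    show (cart (p ^ e) (ψ i.1) (ex i.2) g).IsHomogeneous _
    conv => arg 1; rw [g.as_sum]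
    rw [map_sum]
    apply IsHomogeneous.sum
    intro s hs
    rw [cart_monomial]
    split_ifs with h
    · apply isHomogeneous_monomial
      have h1 : s.degree = D := by
        by_contra hne
        exact (mem_support_iff.mp hs) (hD.coeff_eq_zero hne)
      have h2 : s = p ^ e • s.mapRange (· / p ^ e) (Nat.zero_div _) + ex i.2 := by
        rw [← h]; ext j; simp [Nat.div_add_mod]
      have h3 : s.degree = p ^ e * (s.mapRange (· / p ^ e) (Nat.zero_div _)).degree
          + (ex i.2).degree := by
        conv_lhs => rw [h2]
        simp
      rw [← h1, h3, Nat.add_sub_cancel, Nat.mul_div_cancel_left _ hq]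
    · exact isHomogeneous_zero _ _ _

end Stmt19

namespace Stmt19

lemma frobPow_mono {R : Type*} [CommRing R] (q : ℕ) {A B : Ideal R} (h : A ≤ B) :
    frobPow q A ≤ frobPow q B :=
  Ideal.span_mono (Set.image_mono h)

lemma pow_mem_frobPow {R : Type*} [CommRing R] (q : ℕ) {A : Ideal R} {x : R} (h : x ∈ A) :
    x ^ q ∈ frobPow q A := Ideal.subset_span ⟨x, h, rfl⟩

lemma qlin_mem {R : Type*} [CommRing R] {q : ℕ} {A : Ideal R} {φ : R →+ R}
    (hφ : ∀ r x, φ (r ^ q * x) = r * φ x) {g : R} (hg : g ∈ frobPow q A) : φ g ∈ A := by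
  unfold frobPow at hg
  induction hg using Submodule.span_induction with
  | mem x hx =>
    obtain ⟨y, hy, rfl⟩ := hx
    have := hφ y 1
    simp only [mul_one] at this
    simp only [this]
    exact A.mul_mem_right _ hy
  | zero => simp
  | add x y _ _ hx hy => rw [map_add]; exact A.add_mem hx hy
  | smul a x hx' hx =>
    clear hx
    revert a
    induction hx' using Submodule.span_induction with
    | mem x hx =>
      intro a
      obtain ⟨y, hy, rfl⟩ := hx
      rw [smul_eq_mul, mul_comm]
      simp only [hφ]
      exact A.mul_mem_right _ hy
    | zero => simp
    | add x y _ _ hx hy => intro a; rw [smul_add, map_add]; exact A.add_mem (hx a) (hy a)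
    | smul b x _ hx => intro a; rw [smul_smul]; exact hx _

lemma mem_frobPow_of {σ : Type*} [Fintype σ] {F : Type*} [Field F] {p : ℕ} (hp : p.Prime)
    [CharP F p] (e : ℕ) {A : Ideal (MvPolynomial σ F)} {g : MvPolynomial σ F}
    (h : ∀ φ : MvPolynomial σ F →+ MvPolynomial σ F,
      (∀ r x, φ (r ^ p ^ e * x) = r * φ x) → φ g ∈ A) : g ∈ frobPow (p ^ e) A := by
  obtain ⟨T, φ, b, hφ, hsum, -⟩ := poly_dual hp e g
  rw [← hsum]
  exact Ideal.sum_mem _ fun i _ => Ideal.mul_mem_right _ _ (pow_mem_frobPow _ (h _ (hφ i)))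

lemma le_frobPow_frobRoot {σ : Type*} [Fintype σ] {F : Type*} [Field F] {p : ℕ} (hp : p.Prime)
    [CharP F p] (e : ℕ) (J : Ideal (MvPolynomial σ F)) :
    J ≤ frobPow (p ^ e) (frobRoot (p ^ e) J) := by
  intro g hg
  apply mem_frobPow_of hp
  intro φ hφ
  unfold frobRoot
  rw [Ideal.mem_sInf]
  intro K hK
  exact qlin_mem hφ (hK hg)

/-- Elements `g` with `g z ∈ A`. -/
def col {R : Type*} [CommRing R] (A : Ideal R) (z : R) : Ideal R :=
  Submodule.comap (LinearMap.mulLeft R z) A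

lemma mem_col {R : Type*} [CommRing R] {A : Ideal R} {z g : R} : g ∈ col A z ↔ z * g ∈ A :=
  Iff.rfl

lemma mem_frobPow_col {σ : Type*} [Fintype σ] {F : Type*} [Field F] {p : ℕ} (hp : p.Prime)
    [CharP F p] (e : ℕ) {A : Ideal (MvPolynomial σ F)} {g z : MvPolynomial σ F}
    (h : z ^ p ^ e * g ∈ frobPow (p ^ e) A) : g ∈ frobPow (p ^ e) (col A z) := by
  apply mem_frobPow_of hp
  intro φ hφ
  rw [mem_col, ← hφ]
  exact qlin_mem hφ h

lemma frobPow_frobPow {R : Type*} [CommRing R] {p : ℕ} (e e' : ℕ)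
    (A : Ideal R) : frobPow (p ^ (e + e')) A ≤ frobPow (p ^ e') (frobPow (p ^ e) A) := by
  refine Ideal.span_le.mpr ?_
  rintro _ ⟨x, hx, rfl⟩
  simp only [pow_add, pow_mul]
  exact pow_mem_frobPow _ (pow_mem_frobPow _ hx)

lemma test_compat {σ : Type*} [Fintype σ] {F : Type*} [Field F] {p : ℕ} (hp : p.Prime)
    [CharP F p] (I : Ideal (MvPolynomial σ F)) (c : ℝ) (e : ℕ) {f : MvPolynomial σ F}
    (hf : f ∈ I ^ ⌈c * ((p : ℝ) ^ e - 1)⌉₊) {g : MvPolynomial σ F} (hg : g ∈ testIdeal p c I) :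
    f * g ∈ frobPow (p ^ e) (testIdeal p c I) := by
  suffices h : testIdeal p c I ≤ col (frobPow (p ^ e) (testIdeal p c I)) f from h hg
  conv_lhs => unfold testIdeal
  refine iSup_le fun e' => sInf_le ?_
  intro a ha
  apply mem_frobPow_col hp
  apply frobPow_frobPow
  have h1 : f ^ p ^ e' * a ∈ I ^ ⌈c * (p : ℝ) ^ (e + e')⌉₊ := by
    have h2 : f ^ p ^ e' * a ∈ (I ^ ⌈c * ((p : ℝ) ^ e - 1)⌉₊) ^ p ^ e' * I ^ ⌈c * (p : ℝ) ^ e'⌉₊ :=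
      Ideal.mul_mem_mul (Ideal.pow_mem_pow hf _) ha
    rw [← pow_mul, ← pow_add] at h2
    refine Ideal.pow_le_pow_right ?_ h2
    rw [Nat.ceil_le]
    push_cast
    have h3 := Nat.le_ceil (c * ((p : ℝ) ^ e - 1))
    have h4 := Nat.le_ceil (c * (p : ℝ) ^ e')
    have h5 : (0 : ℝ) ≤ (p : ℝ) ^ e' := by positivity
    have h6 := mul_le_mul_of_nonneg_right h3 h5
    rw [pow_add]
    nlinarith
  refine frobPow_mono _ ?_ (le_frobPow_frobRoot hp (e + e') _ h1)
  exact le_iSup (fun e : ℕ => frobRoot (p ^ e) (I ^ ⌈c * (p : ℝ) ^ e⌉₊)) (e + e')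

/-- An ideal generated by forms. -/
def HomId {σ : Type*} {F : Type*} [Field F] (A : Ideal (MvPolynomial σ F)) : Prop :=
  ∃ T : Set (MvPolynomial σ F), (∀ t ∈ T, ∃ D, t.IsHomogeneous D) ∧ A = Ideal.span T

section

attribute [local instance] MvPolynomial.gradedAlgebra

lemma HomId.comp_mem {σ : Type*} {F : Type*} [Field F] {A : Ideal (MvPolynomial σ F)}
    (hA : HomId A) {g : MvPolynomial σ F} (hg : g ∈ A) (i : ℕ) : homogeneousComponent i g ∈ A := by
  obtain ⟨T, hT, rfl⟩ := hA
  refine homogeneousComponent_mem_of_mem (Ideal.homogeneous_span _ _ ?_) hg i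
  intro x hx
  obtain ⟨D, hD⟩ := hT x hx
  exact ⟨D, hD⟩

end

lemma HomId.iSup {ι : Sort*} {σ : Type*} {F : Type*} [Field F] {A : ι → Ideal (MvPolynomial σ F)}
    (hA : ∀ i, HomId (A i)) : HomId (⨆ i, A i) := by
  choose T hT hA using hA
  refine ⟨⋃ i, T i, ?_, ?_⟩
  · intro t ht
    obtain ⟨i, hi⟩ := Set.mem_iUnion.mp ht
    exact hT i t hi
  · rw [Ideal.span_iUnion]; exact iSup_congr hA

lemma HomId.sup {σ : Type*} {F : Type*} [Field F] {A B : Ideal (MvPolynomial σ F)}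
    (hA : HomId A) (hB : HomId B) : HomId (A ⊔ B) := by
  obtain ⟨T, hT, rfl⟩ := hA
  obtain ⟨T', hT', rfl⟩ := hB
  refine ⟨T ∪ T', ?_, (Ideal.span_union _ _).symm⟩
  rintro t (ht | ht)
  exacts [hT t ht, hT' t ht]

lemma HomId.map {σ : Type*} {F E : Type*} [Field F] [Field E] (θ : F →+* E)
    {A : Ideal (MvPolynomial σ F)} (hA : HomId A) : HomId (A.map (MvPolynomial.map (σ := σ) θ)) := by
  obtain ⟨T, hT, rfl⟩ := hA
  refine ⟨MvPolynomial.map θ '' T, ?_, Ideal.map_span _ _⟩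
  rintro _ ⟨t, ht, rfl⟩
  obtain ⟨D, hD⟩ := hT t ht
  exact ⟨D, hD.map _⟩

open scoped Pointwise in
lemma pow_span_homog {σ : Type*} {F : Type*} [Field F] {S : Set (MvPolynomial σ F)} {d : ℕ}
    (hS : ∀ f ∈ S, f.IsHomogeneous d) (N : ℕ) :
    ∃ T : Set (MvPolynomial σ F), (∀ f ∈ T, f.IsHomogeneous (d * N)) ∧
      Ideal.span S ^ N = Ideal.span T := by
  induction N with
  | zero => exact ⟨{1}, by simp [isHomogeneous_one], by simp [Ideal.one_eq_top]⟩
  | succ N ih =>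
    obtain ⟨T, hT, h⟩ := ih
    refine ⟨T * S, ?_, ?_⟩
    · rintro _ ⟨a, ha, b, hb, rfl⟩
      exact (hT a ha).mul (hS b hb)
    · rw [pow_succ, h, Ideal.span_mul_span']

lemma HomId.frobRoot {σ : Type*} [Fintype σ] {F : Type*} [Field F] {p : ℕ} (hp : p.Prime)
    [CharP F p] (e : ℕ) {A : Ideal (MvPolynomial σ F)} (hA : HomId A) :
    HomId (frobRoot (p ^ e) A) := by
  refine ⟨{t | t ∈ _root_.frobRoot (p ^ e) A ∧ ∃ D, t.IsHomogeneous D}, fun t ht => ht.2, ?_⟩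
  apply le_antisymm
  · refine sInf_le ?_
    obtain ⟨T, hT, rfl⟩ := hA
    refine Ideal.span_le.mpr ?_
    intro g hg
    obtain ⟨T', φ, b, hφ, hsum, hh⟩ := poly_dual hp e g
    obtain ⟨D, hD⟩ := hT g hg
    rw [SetLike.mem_coe, ← hsum]
    refine Ideal.sum_mem _ fun i _ => Ideal.mul_mem_right _ _ (pow_mem_frobPow _ ?_)
    refine Ideal.subset_span ⟨?_, hh D hD i⟩
    exact qlin_mem (hφ i) (le_frobPow_frobRoot hp e _ (Ideal.subset_span hg))
  · exact Ideal.span_le.mpr fun t ht => ht.1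

lemma HomId.testIdeal {σ : Type*} [Fintype σ] {F : Type*} [Field F] {p : ℕ} (hp : p.Prime)
    [CharP F p] {S : Set (MvPolynomial σ F)} {d : ℕ}
    (hS : ∀ f ∈ S, f.IsHomogeneous d) (c : ℝ) :
    HomId (testIdeal p c (Ideal.span S)) := by
  refine HomId.iSup fun e => HomId.frobRoot hp e ?_
  obtain ⟨T, hT, h⟩ := pow_span_homog hS ⌈c * (p : ℝ) ^ e⌉₊
  exact ⟨T, fun t ht => ⟨_, hT t ht⟩, h⟩

/-- Monomial criterion: elements outside `m^[q]`. -/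
lemma exists_monomial {n : ℕ} {F : Type*} [Field F] {q : ℕ}
    {f : MvPolynomial (Fin (n + 1)) F} (hf : f ∉ frobPow q (maxIdl n F)) :
    ∃ u : Fin (n + 1) →₀ ℕ, coeff u f ≠ 0 ∧ ∀ i, u i < q := by
  by_contra! hcon
  apply hf
  rw [f.as_sum]
  refine Ideal.sum_mem _ fun u hu => ?_
  obtain ⟨i, hi⟩ := hcon u (mem_support_iff.mp hu)
  have h1 : monomial u (coeff u f) =
      monomial (u - Finsupp.single i q) (coeff u f) * (X i) ^ q := by
    rw [X_pow_eq_monomial, monomial_mul, mul_one, tsub_add_cancel_of_le]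
    simpa using hi
  rw [h1]
  exact Ideal.mul_mem_left _ _ (pow_mem_frobPow _ (Ideal.subset_span ⟨i, rfl⟩))

lemma coeff_zero_of_mem {n : ℕ} {F : Type*} [Field F] {p : ℕ} (hp : p.Prime) [CharP F p] (e : ℕ)
    {f : MvPolynomial (Fin (n + 1)) F} (hf : f ∈ frobPow (p ^ e) (maxIdl n F))
    (u : Fin (n + 1) →₀ ℕ) (hu : ∀ i, u i < p ^ e) : coeff u f = 0 := by
  have := Fact.mk hp
  have hle : frobPow (p ^ e) (maxIdl n F) ≤
      Ideal.span ((fun s : Fin (n + 1) →₀ ℕ => monomial s (1 : F)) ''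
        (Set.range fun i => Finsupp.single i (p ^ e))) := by
    refine Ideal.span_le.mpr ?_
    rintro _ ⟨x, hx, rfl⟩
    have : maxIdl n F ≤ Ideal.comap (iterateFrobenius (MvPolynomial (Fin (n + 1)) F) p e)
        (Ideal.span ((fun s : Fin (n + 1) →₀ ℕ => monomial s (1 : F)) ''
        (Set.range fun i => Finsupp.single i (p ^ e)))) := by
      refine Ideal.span_le.mpr ?_
      rintro _ ⟨i, rfl⟩
      refine Ideal.subset_span ⟨_, ⟨i, rfl⟩, ?_⟩
      simp [iterateFrobenius_def, X_pow_eq_monomial]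
    exact this hx
  by_contra hne
  obtain ⟨_, ⟨i, rfl⟩, hi⟩ := mem_ideal_span_monomial_image.mp (hle hf) u (mem_support_iff.mpr hne)
  have := hi i
  simp at this
  exact absurd (hu i) (not_lt.mpr this)

end Stmt19

namespace Stmt19

/-- The linear form with given coefficient vector. -/
def lf (n : ℕ) (F : Type*) [Field F] : (Fin (n + 1) → F) →ₗ[F] MvPolynomial (Fin (n + 1)) F :=
  Fintype.linearCombination F X

lemma lf_apply {n : ℕ} {F : Type*} [Field F] (v : Fin (n + 1) → F) :
    lf n F v = ∑ i, v i • X i := rfl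

lemma lf_homog {n : ℕ} {F : Type*} [Field F] (v : Fin (n + 1) → F) :
    (lf n F v).IsHomogeneous 1 := by
  rw [lf_apply]
  apply IsHomogeneous.sum
  intro i _
  rw [smul_eq_C_mul]
  exact isHomogeneous_C_mul_X _ _

lemma lf_single {n : ℕ} {F : Type*} [Field F] (i : Fin (n + 1)) :
    lf n F (Pi.single i 1) = X i := by
  simp [lf]

lemma maxIdl_eq_ker {n : ℕ} {F : Type*} [Field F] :
    maxIdl n F = RingHom.ker (constantCoeff : MvPolynomial (Fin (n + 1)) F →+* F) := by
  ext g
  unfold maxIdl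
  rw [← Set.image_univ, mem_ideal_span_X_image, RingHom.mem_ker, constantCoeff_eq]
  constructor
  · intro h
    by_contra hne
    obtain ⟨i, _, hi⟩ := h 0 (mem_support_iff.mpr hne)
    simp at hi
  · intro h s hs
    by_contra! hcon
    have : s = 0 := by ext i; simpa using hcon i
    subst this
    exact mem_support_iff.mp hs h

instance maxIdl_prime {n : ℕ} {F : Type*} [Field F] : (maxIdl n F).IsPrime := by
  rw [maxIdl_eq_ker]; exact RingHom.ker_isPrime _

lemma mem_maxIdl {n : ℕ} {F : Type*} [Field F] {g : MvPolynomial (Fin (n + 1)) F} :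
    g ∈ maxIdl n F ↔ coeff 0 g = 0 := by
  rw [maxIdl_eq_ker, RingHom.mem_ker, constantCoeff_eq]

lemma maxIdl_height {n : ℕ} {F : Type*} [Field F] : (maxIdl n F).height ≤ (n + 1 : ℕ) := by
  classical
  have h := Ideal.height_le_card_of_mem_minimalPrimes_span_finset (p := maxIdl n F)
    (s := Finset.univ.image (X : Fin (n + 1) → MvPolynomial (Fin (n + 1)) F)) (by
      have : Ideal.span ((Finset.univ.image (X : Fin (n + 1) → MvPolynomial (Fin (n + 1)) F) :
          Finset _) : Set (MvPolynomial (Fin (n + 1)) F)) = maxIdl n F := by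
        simp [maxIdl]
      rw [this, Ideal.minimalPrimes_eq_subsingleton_self]
      rfl)
  refine h.trans ?_
  have := Finset.card_image_le (s := Finset.univ) (f := (X : Fin (n + 1) → MvPolynomial (Fin (n + 1)) F))
  simp only [Finset.card_univ, Fintype.card_fin] at this
  exact_mod_cast this

lemma height_succ_le {R : Type*} [CommRing R] {P Q : Ideal R} [P.IsPrime] [Q.IsPrime]
    (h : P < Q) : P.height + 1 ≤ Q.height := by
  have h1 := PrimeSpectrum.height_eq_orderHeight (⟨P, ‹_›⟩ : PrimeSpectrum R)
  have h2 := PrimeSpectrum.height_eq_orderHeight (⟨Q, ‹_›⟩ : PrimeSpectrum R)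
  simp only at h1 h2
  rw [h1, h2]
  exact Order.height_add_one_le (show (⟨P, ‹_›⟩ : PrimeSpectrum R) < ⟨Q, ‹_›⟩ from h)

/-- Choice of a linear form avoiding the minimal primes that do not contain the variables. -/
lemma exists_avoid {n : ℕ} {F : Type*} [Field F] [Infinite F]
    (A : Ideal (MvPolynomial (Fin (n + 1)) F)) :
    ∃ v : Fin (n + 1) → F, ∀ P ∈ A.minimalPrimes, lf n F v ∈ P → maxIdl n F ≤ P := by
  classical
  have hfin := A.finite_minimalPrimes_of_isNoetherianRing
  let V : Ideal (MvPolynomial (Fin (n + 1)) F) → Subspace F (Fin (n + 1) → F) := fun P =>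
    (P.restrictScalars F).comap (lf n F)
  let s : Finset (Subspace F (Fin (n + 1) → F)) :=
    (hfin.toFinset.filter (fun P => ¬ maxIdl n F ≤ P)).image V
  have htop : ⊤ ∉ s := by
    intro h
    obtain ⟨P, hP, hV⟩ := Finset.mem_image.mp h
    apply (Finset.mem_filter.mp hP).2
    refine Ideal.span_le.mpr ?_
    rintro _ ⟨i, rfl⟩
    have : Pi.single i 1 ∈ V P := by rw [hV]; trivial
    have h2 : lf n F (Pi.single i 1) ∈ P := this
    rwa [lf_single] at h2
  have hne := Subspace.biUnion_ne_univ_of_top_notMem htop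
  obtain ⟨v, hv⟩ := (Set.ne_univ_iff_exists_notMem _).mp hne
  refine ⟨v, fun P hP hvP => ?_⟩
  by_contra hcon
  apply hv
  refine Set.mem_biUnion (x := V P) ?_ hvP
  exact Finset.mem_image_of_mem _ (Finset.mem_filter.mpr ⟨hfin.mem_toFinset.mpr hP, hcon⟩)

lemma exists_sop_aux {n : ℕ} {F : Type*} [Field F] [Infinite F] (t : ℕ) :
    ∀ (h : ℕ) (A : Ideal (MvPolynomial (Fin (n + 1)) F)),
    (∀ P : Ideal (MvPolynomial (Fin (n + 1)) F), P.IsPrime → A ≤ P → P ≤ maxIdl n F →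
      ((h : ℕ∞) ≤ P.height ∨ P = maxIdl n F)) →
    ∃ w : Fin t → (Fin (n + 1) → F), ∀ P : Ideal (MvPolynomial (Fin (n + 1)) F), P.IsPrime →
      A ⊔ Ideal.span (Set.range fun a => lf n F (w a)) ≤ P → P ≤ maxIdl n F →
      (((h + t : ℕ) : ℕ∞) ≤ P.height ∨ P = maxIdl n F) := by
  induction t with
  | zero =>
    intro h A hA
    refine ⟨fun i => i.elim0, fun P hP hAP hPm => ?_⟩
    simpa using hA P hP (le_sup_left.trans hAP) hPm
  | succ t ih =>
    intro h A hA
    obtain ⟨v, hv⟩ := exists_avoid A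
    obtain ⟨w, hw⟩ := ih (h + 1) (A ⊔ Ideal.span {lf n F v}) (by
      intro P hP hAP hPm
      obtain ⟨Q, hQ, hQP⟩ := Ideal.exists_minimalPrimes_le (le_sup_left.trans hAP)
      have hQp : Q.IsPrime := hQ.1.1
      rcases eq_or_lt_of_le hQP with rfl | hlt
      · right
        refine le_antisymm hPm (hv Q hQ ?_)
        exact hAP (Ideal.mem_sup_right (Ideal.mem_span_singleton_self _))
      · left
        rcases hA Q hQp hQ.1.2 (hQP.trans hPm) with h1 | h1
        · push_cast
          exact (add_le_add_left h1 1).trans (height_succ_le hlt)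
        · exact absurd (lt_of_lt_of_le hlt hPm) (by rw [h1]; exact lt_irrefl _))
    refine ⟨Fin.cons v w, fun P hP hAP hPm => ?_⟩
    have := hw P hP (by
      refine le_trans (le_of_eq ?_) hAP
      rw [sup_assoc, ← Ideal.span_union]
      congr 2
      ext x
      simp [Fin.exists_fin_succ, eq_comm]) hPm
    rwa [add_assoc, add_comm 1 t] at this

lemma exists_sop {n h t : ℕ} {F : Type*} [Field F] [Infinite F] (hht : h + t = n + 1)
    (A : Ideal (MvPolynomial (Fin (n + 1)) F))
    (hA : ∀ P : Ideal (MvPolynomial (Fin (n + 1)) F), P.IsPrime → A ≤ P → (h : ℕ∞) ≤ P.height) :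
    ∃ w : Fin t → (Fin (n + 1) → F), ∀ P : Ideal (MvPolynomial (Fin (n + 1)) F), P.IsPrime →
      A ⊔ Ideal.span (Set.range fun a => lf n F (w a)) ≤ P → P ≤ maxIdl n F → P = maxIdl n F := by
  obtain ⟨w, hw⟩ := exists_sop_aux t h A (fun P hP hAP _ => Or.inl (hA P hP hAP))
  refine ⟨w, fun P hP hAP hPm => ?_⟩
  rcases hw P hP hAP hPm with h1 | h1
  · by_contra hne
    have hlt := lt_of_le_of_ne hPm hne
    have h2 := (height_succ_le hlt).trans maxIdl_height
    have h3 := (add_le_add_left h1 1).trans h2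
    rw [hht] at h3
    norm_cast at h3
    omega
  · exact h1

lemma comp_mul {σ : Type*} {F : Type*} [Field F] (r : MvPolynomial σ F) {g : MvPolynomial σ F}
    {a : ℕ} (hg : g.IsHomogeneous a) (j : ℕ) :
    homogeneousComponent (j + a) (r * g) = homogeneousComponent j r * g := by
  induction r using MvPolynomial.induction_on' with
  | add x y hx hy => rw [add_mul, map_add, hx, hy, map_add, add_mul]
  | monomial s c =>
    have h1 : (monomial s c).IsHomogeneous s.degree := isHomogeneous_monomial c rfl
    rw [homogeneousComponent_of_mem (h1.mul hg), homogeneousComponent_of_mem h1]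
    by_cases h : j = s.degree
    · simp [h]
    · rw [if_neg h, if_neg (by omega), zero_mul]

lemma exists_pow_le {n : ℕ} {F : Type*} [Field F] {B : Ideal (MvPolynomial (Fin (n + 1)) F)}
    (hB : HomId B) (h : ∀ P : Ideal (MvPolynomial (Fin (n + 1)) F), P.IsPrime →
      B ≤ P → P ≤ maxIdl n F → P = maxIdl n F) : ∃ c, maxIdl n F ^ c ≤ B := by
  refine Ideal.exists_pow_le_of_le_radical_of_fg ?_ (IsNoetherian.noetherian _)
  refine Ideal.span_le.mpr ?_
  rintro _ ⟨i, rfl⟩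
  let M : Submonoid (MvPolynomial (Fin (n + 1)) F) :=
    (maxIdl n F).primeCompl ⊔ Submonoid.powers (X i)
  have hnd : ¬ Disjoint (B : Set (MvPolynomial (Fin (n + 1)) F)) M := by
    intro hd
    obtain ⟨P, hP, hBP, hPd⟩ := Ideal.exists_le_prime_disjoint B M hd
    have hPm : P ≤ maxIdl n F := by
      intro g hg
      by_contra hgm
      exact Set.disjoint_left.mp hPd hg (Submonoid.mem_sup_left hgm)
    have := h P hP hBP hPm
    have hX : X i ∈ P := by rw [this]; exact Ideal.subset_span ⟨i, rfl⟩
    exact Set.disjoint_left.mp hPd hX (Submonoid.mem_sup_right (Submonoid.mem_powers _))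
  obtain ⟨x, hxB, hxM⟩ := Set.not_disjoint_iff.mp hnd
  obtain ⟨r, hr, z, ⟨a, rfl⟩, rfl⟩ := Submonoid.mem_sup.mp hxM
  have h0 : coeff 0 r ≠ 0 := fun h0 => hr (mem_maxIdl.mpr h0)
  refine ⟨a, ?_⟩
  have h1 := hB.comp_mem hxB (0 + a)
  rw [comp_mul r (isHomogeneous_X_pow i a), homogeneousComponent_zero] at h1
  have h2 := B.mul_mem_left (C (coeff 0 r)⁻¹) h1
  rwa [← mul_assoc, ← C_mul, inv_mul_cancel₀ h0, C_1, one_mul] at h2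

lemma mem_pow_max {n : ℕ} {F : Type*} [Field F] {g : MvPolynomial (Fin (n + 1)) F} {j c : ℕ}
    (hg : g.IsHomogeneous j) (hc : c ≤ j) : g ∈ maxIdl n F ^ c := by
  change g ∈ idealOfVars _ _ ^ c
  rw [mem_pow_idealOfVars_iff]
  intro s hs
  have : s.degree = j := by
    by_contra hne
    exact (mem_support_iff.mp hs) (hg.coeff_eq_zero hne)
  omega

lemma reduction {n t c : ℕ} {F : Type*} [Field F] {J : Ideal (MvPolynomial (Fin (n + 1)) F)}
    (hJ : HomId J) (y : Fin t → MvPolynomial (Fin (n + 1)) F) (hy : ∀ a, (y a).IsHomogeneous 1)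
    (hc : maxIdl n F ^ c ≤ J ⊔ Ideal.span (Set.range y)) (i : ℕ) :
    ∀ (j : ℕ) (g : MvPolynomial (Fin (n + 1)) F), g.IsHomogeneous j → c + i ≤ j →
      g ∈ J ⊔ Ideal.span (Set.range y) ^ i := by
  induction i with
  | zero => intro j g _ _; simp [Ideal.one_eq_top]
  | succ i ih =>
    intro j g hg hj
    obtain ⟨a, ha, b, hb, hab⟩ := Submodule.mem_sup.mp (hc (mem_pow_max hg (by omega)))
    obtain ⟨r, rfl⟩ := (Ideal.mem_span_range_iff_exists_fun).mp hb
    obtain ⟨j, rfl⟩ : ∃ j', j = j' + 1 := ⟨j - 1, by omega⟩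
    have h1 : g = homogeneousComponent (j + 1) a + ∑ α, homogeneousComponent j (r α) * y α := by
      rw [← homogeneousComponent_eq_self hg, ← hab, map_add, map_sum]
      simp only [comp_mul _ (hy _)]
    rw [h1]
    refine Ideal.add_mem _ (Ideal.mem_sup_left (hJ.comp_mem ha _)) (Ideal.sum_mem _ fun α _ => ?_)
    have h2 := ih j _ (homogeneousComponent_isHomogeneous j (r α)) (by omega)
    have h3 : homogeneousComponent j (r α) * y α ∈
        (J ⊔ Ideal.span (Set.range y) ^ i) * Ideal.span (Set.range y) :=
      Ideal.mul_mem_mul h2 (Ideal.subset_span ⟨α, rfl⟩)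
    rw [Ideal.sup_mul, ← pow_succ] at h3
    have h4 : J * Ideal.span (Set.range y) ⊔ Ideal.span (Set.range y) ^ (i + 1) ≤
        J ⊔ Ideal.span (Set.range y) ^ (i + 1) :=
      sup_le (Ideal.mul_le_left.trans le_sup_left) le_sup_right
    exact h4 h3

lemma span_pow_le {R : Type*} [CommRing R] (q t : ℕ) :
    ∀ y : Fin t → R, Ideal.span (Set.range y) ^ (t * q + 1) ≤
      Ideal.span (Set.range fun a => y a ^ q) := by
  induction t with
  | zero => intro y; simp
  | succ t ih =>
    intro y
    have h1 : ∀ z : Fin (t + 1) → R, Ideal.span (Set.range z) =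
        Ideal.span {z 0} ⊔ Ideal.span (Set.range fun a : Fin t => z a.succ) := by
      intro z
      rw [← Ideal.span_union]
      congr 1
      ext x
      simp [Fin.exists_fin_succ, eq_comm]
    rw [h1 y, h1 (fun a => y a ^ q), show (t + 1) * q + 1 = q + (t * q + 1) by ring]
    refine Ideal.sup_pow_add_le_pow_sup_pow.trans (sup_le_sup ?_ (ih _))
    rw [Ideal.span_singleton_pow]

/-- The key lemma over an infinite field. -/
lemma key {n h t d : ℕ} {F : Type*} [Field F] [Infinite F] {p : ℕ} (hp : p.Prime) [CharP F p]
    (hht : h + t = n + 1) {J : Ideal (MvPolynomial (Fin (n + 1)) F)} (hJ : HomId J)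
    (hJh : ∀ P : Ideal (MvPolynomial (Fin (n + 1)) F), P.IsPrime → J ≤ P → (h : ℕ∞) ≤ P.height)
    (hf : ∀ M : ℕ, ∃ e, M ≤ p ^ e ∧ ∃ (f : MvPolynomial (Fin (n + 1)) F) (D : ℕ),
      f.IsHomogeneous D ∧ f ∉ frobPow (p ^ e) (maxIdl n F) ∧ D ≤ h * (p ^ e - 1) + d ∧
      ∀ g ∈ J, f * g ∈ frobPow (p ^ e) J) :
    ∃ w : Fin t → (Fin (n + 1) → F), ∀ i, ∃ r : MvPolynomial (Fin (n + 1)) F, coeff 0 r ≠ 0 ∧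
      X i * r ∈ J ⊔ Ideal.span (Set.range fun a => lf n F (w a)) := by
  obtain ⟨w, hw⟩ := exists_sop hht J hJh
  refine ⟨w, fun i => ?_⟩
  set y := fun a => lf n F (w a) with hy
  set B := J ⊔ Ideal.span (Set.range y) with hBdef
  have hB : HomId B := hJ.sup ⟨Set.range y, by
    rintro _ ⟨a, rfl⟩; exact ⟨1, lf_homog _⟩, rfl⟩
  obtain ⟨c, hc⟩ := exists_pow_le hB hw
  obtain ⟨e, hM, f, D, hfD, hfm, hD, hfJ⟩ := hf (c + t + d + 1)
  by_contra! hcon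
  obtain ⟨u, hu, huq⟩ := exists_monomial hfm
  have hcol : col B (X i) ≤ maxIdl n F := by
    intro r hr
    rw [mem_maxIdl]
    by_contra h0
    exact hcon r h0 hr
  let v : Fin (n + 1) →₀ ℕ := Finsupp.equivFunOnFinite.symm (fun j => p ^ e - 1 - u j)
  have hdegu : u.degree = D := by
    by_contra hne
    exact hu (hfD.coeff_eq_zero hne)
  have hsum : v.degree + u.degree = (n + 1) * (p ^ e - 1) := by
    rw [Finsupp.degree_eq_sum, Finsupp.degree_eq_sum, ← Finset.sum_add_distrib]
    rw [Finset.sum_congr rfl (g := fun _ => p ^ e - 1)]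
    · simp
    · intro j _
      have := huq j
      simp only [v, Finsupp.equivFunOnFinite_symm_apply_apply]
      omega
  have hmon : (X i ^ p ^ e * monomial v (1 : F)).IsHomogeneous (p ^ e + v.degree) :=
    (isHomogeneous_X_pow i _).mul (isHomogeneous_monomial _ rfl)
  have hdeg : c + (t * p ^ e + 1) ≤ p ^ e + v.degree := by
    have aux : ∀ q V U : ℕ, c + t + d + 1 ≤ q → D ≤ h * (q - 1) + d → U = D →
        V + U = (n + 1) * (q - 1) → c + (t * q + 1) ≤ q + V := by
      intro q V U h1 h2 h3 h4
      obtain ⟨Q, rfl⟩ : ∃ Q, q = Q + 1 := ⟨q - 1, by omega⟩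
      simp only [Nat.add_sub_cancel] at h2 h4
      have h9 : (n + 1) * Q = h * Q + t * Q := by rw [← add_mul, hht]
      have h10 : t * (Q + 1) = t * Q + t := by ring
      omega
    exact aux _ _ _ hM hD hdegu hsum
  have h1 := reduction hJ y (fun a => lf_homog _) hc _ _ _ hmon hdeg
  have h2 := sup_le_sup_left (span_pow_le (p ^ e) t y) J h1
  obtain ⟨a, ha, b, hb, hab⟩ := Submodule.mem_sup.mp h2
  have h3 : X i ^ p ^ e * (f * monomial v (1 : F)) ∈ frobPow (p ^ e) B := by
    rw [mul_left_comm, ← hab, mul_add]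
    refine Ideal.add_mem _ (frobPow_mono _ le_sup_left (hfJ a ha)) (Ideal.mul_mem_left _ _ ?_)
    refine Ideal.span_le.mpr ?_ hb
    rintro _ ⟨α, rfl⟩
    exact pow_mem_frobPow _ (Ideal.mem_sup_right (Ideal.subset_span ⟨α, rfl⟩))
  have h4 := frobPow_mono _ hcol (mem_frobPow_col hp e h3)
  have h5 := coeff_zero_of_mem hp e h4 (u + v) (by
    intro j
    have := huq j
    simp only [v, Finsupp.add_apply, Finsupp.equivFunOnFinite_symm_apply_apply]
    omega)
  rw [coeff_mul_monomial, mul_one] at h5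
  exact hu h5

end Stmt19

namespace Stmt19

lemma height_comap_le {n : ℕ} {F E : Type*} [Field F] [Field E] [Algebra F E]
    (P : Ideal (MvPolynomial (Fin (n + 1)) E)) [P.IsPrime] :
    (P.comap (MvPolynomial.map (algebraMap F E))).height ≤ P.height := by
  let _ : Algebra (MvPolynomial (Fin (n + 1)) F) (MvPolynomial (Fin (n + 1)) E) :=
    MvPolynomial.algebraMvPolynomial
  have hb : IsBaseChange (MvPolynomial (Fin (n + 1)) F)
      (IsScalarTower.toAlgHom F E (MvPolynomial (Fin (n + 1)) E)).toLinearMap :=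
    (inferInstance : Algebra.IsPushout F (MvPolynomial (Fin (n + 1)) F) E
      (MvPolynomial (Fin (n + 1)) E)).out
  have hflat : Module.Flat (MvPolynomial (Fin (n + 1)) F) (MvPolynomial (Fin (n + 1)) E) :=
    Module.Flat.isBaseChange F _ E _ hb
  have := Ideal.height_eq_height_add_of_liesOver_of_hasGoingDown
    (P.under (MvPolynomial (Fin (n + 1)) F)) P
  have h2 : (P.under (MvPolynomial (Fin (n + 1)) F)).height ≤ P.height := by
    rw [this]; exact le_self_add
  exact h2

/-- Vector of linear coefficients. -/
def cv (n : ℕ) (F : Type*) [Field F] : MvPolynomial (Fin (n + 1)) F →ₗ[F] (Fin (n + 1) → F) :=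
  LinearMap.pi fun i => lcoeff F (Finsupp.single i 1)

lemma cv_apply {n : ℕ} {F : Type*} [Field F] (g : MvPolynomial (Fin (n + 1)) F) (i) :
    cv n F g i = coeff (Finsupp.single i 1) g := rfl

lemma cv_lf {n : ℕ} {F : Type*} [Field F] (v : Fin (n + 1) → F) : cv n F (lf n F v) = v := by
  classical
  ext i
  rw [cv_apply, lf_apply]
  simp [coeff_sum, coeff_smul, coeff_X, Finsupp.single_left_inj]

lemma lf_cv {n : ℕ} {F : Type*} [Field F] (g : MvPolynomial (Fin (n + 1)) F) :
    lf n F (cv n F g) = homogeneousComponent 1 g := by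
  classical
  induction g using MvPolynomial.induction_on' with
  | add x y hx hy => rw [map_add, map_add, hx, hy, map_add]
  | monomial s c =>
    rw [homogeneousComponent_of_mem (isHomogeneous_monomial c rfl), lf_apply]
    by_cases h : 1 = s.degree
    · obtain ⟨i, rfl⟩ : ∃ i, s = Finsupp.single i 1 := by
        have hs : s ≠ 0 := by rintro rfl; simp at h
        obtain ⟨i, hi⟩ := Finsupp.ne_iff.mp hs
        refine ⟨i, ?_⟩
        have h1 : Finsupp.single i 1 ≤ s := by
          rw [Finsupp.single_le_iff]
          exact Nat.one_le_iff_ne_zero.mpr hi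
        obtain ⟨z, rfl⟩ := exists_add_of_le h1
        rw [map_add, Finsupp.degree_single] at h
        have h2 : z.degree = 0 := by omega
        rw [(Finsupp.degree_eq_zero_iff z).mp h2, add_zero]
      rw [if_pos h]
      rw [Finset.sum_eq_single i]
      · rw [cv_apply, coeff_monomial, if_pos rfl, X, smul_monomial, smul_eq_mul, mul_one]
      · intro j _ hj
        rw [cv_apply, coeff_monomial, if_neg, zero_smul]
        rw [Finsupp.single_left_inj one_ne_zero]
        exact fun h => hj h.symm
      · simp
    · rw [if_neg h]
      refine Finset.sum_eq_zero fun i _ => ?_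
      rw [cv_apply, coeff_monomial, if_neg, zero_smul]
      rintro rfl
      simp at h

lemma coeff_single_mul {n : ℕ} {F : Type*} [Field F] (g r : MvPolynomial (Fin (n + 1)) F)
    (i : Fin (n + 1)) : coeff (Finsupp.single i 1) (g * r) =
      coeff (Finsupp.single i 1) g * coeff 0 r + coeff 0 g * coeff (Finsupp.single i 1) r := by
  classical
  rw [coeff_mul, Finsupp.antidiagonal_single]
  simp [Finset.Nat.antidiagonal_succ]
  ring

lemma cv_mul {n : ℕ} {F : Type*} [Field F] (g r : MvPolynomial (Fin (n + 1)) F) :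
    cv n F (g * r) = coeff 0 r • cv n F g + coeff 0 g • cv n F r := by
  ext i
  simp only [cv_apply, Pi.add_apply, Pi.smul_apply, smul_eq_mul, coeff_single_mul]
  ring

lemma coeff_zero_lf {n : ℕ} {F : Type*} [Field F] (v : Fin (n + 1) → F) :
    coeff 0 (lf n F v) = 0 := by
  simp [lf_apply, coeff_sum, coeff_smul]

/-- The space of linear forms in `J`. -/
def linPart {n : ℕ} {F : Type*} [Field F] (J : Ideal (MvPolynomial (Fin (n + 1)) F)) :
    Submodule F (Fin (n + 1) → F) := (J.restrictScalars F).comap (lf n F)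

lemma mem_linPart {n : ℕ} {F : Type*} [Field F] {J : Ideal (MvPolynomial (Fin (n + 1)) F)}
    {v : Fin (n + 1) → F} : v ∈ linPart J ↔ lf n F v ∈ J := Iff.rfl

lemma cv_mem_linPart {n : ℕ} {F : Type*} [Field F] {J : Ideal (MvPolynomial (Fin (n + 1)) F)}
    (hJ : HomId J) {g : MvPolynomial (Fin (n + 1)) F} (hg : g ∈ J) : cv n F g ∈ linPart J := by
  rw [mem_linPart, lf_cv]; exact hJ.comp_mem hg 1

/-- Scalar extension of vectors. -/
def ev (n : ℕ) {F E : Type*} [Field F] [Field E] (θ : F →+* E) (v : Fin (n + 1) → F) :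
    Fin (n + 1) → E := fun i => θ (v i)

lemma cv_map_mem {n : ℕ} {F E : Type*} [Field F] [Field E] (θ : F →+* E)
    {J : Ideal (MvPolynomial (Fin (n + 1)) F)} (hJ : HomId J) (hJm : J ≤ maxIdl n F)
    {g : MvPolynomial (Fin (n + 1)) E} (hg : g ∈ J.map (MvPolynomial.map θ)) :
    coeff 0 g = 0 ∧ cv n E g ∈ Submodule.span E (ev n θ '' linPart J) := by
  unfold Ideal.map at hg
  induction hg using Submodule.span_induction with
  | mem x hx =>
    obtain ⟨j, hj, rfl⟩ := hx
    constructor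
    · rw [coeff_map, mem_maxIdl.mp (hJm hj), map_zero]
    · refine Submodule.subset_span ⟨cv n F j, cv_mem_linPart hJ hj, ?_⟩
      ext i
      simp [cv_apply, ev, coeff_map]
  | zero => simp
  | add x y _ _ hx hy =>
    refine ⟨by rw [coeff_add, hx.1, hy.1, add_zero], ?_⟩
    rw [map_add]; exact Submodule.add_mem _ hx.2 hy.2
  | smul a x _ hx =>
    rw [smul_eq_mul]
    refine ⟨?_, ?_⟩
    · rw [← constantCoeff_eq, map_mul, constantCoeff_eq, hx.1, mul_zero]
    · rw [cv_mul, hx.1, zero_smul, zero_add]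
      exact Submodule.smul_mem _ _ hx.2

lemma cv_span_lf {n t : ℕ} {E : Type*} [Field E] (w : Fin t → Fin (n + 1) → E)
    {g : MvPolynomial (Fin (n + 1)) E}
    (hg : g ∈ Ideal.span (Set.range fun a => lf n E (w a))) :
    cv n E g ∈ Submodule.span E (Set.range w) := by
  obtain ⟨r, rfl⟩ := (Ideal.mem_span_range_iff_exists_fun).mp hg
  rw [map_sum]
  refine Submodule.sum_mem _ fun a _ => ?_
  rw [cv_mul, coeff_zero_lf, zero_smul, zero_add, cv_lf]
  exact Submodule.smul_mem _ _ (Submodule.subset_span ⟨a, rfl⟩)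

lemma finrank_linPart {n h t : ℕ} {F E : Type*} [Field F] [Field E] (θ : F →+* E)
    (hht : h + t = n + 1)
    {J : Ideal (MvPolynomial (Fin (n + 1)) F)} (hJ : HomId J) (hJm : J ≤ maxIdl n F)
    (w : Fin t → (Fin (n + 1) → E)) (hw : ∀ i, ∃ r : MvPolynomial (Fin (n + 1)) E,
      coeff 0 r ≠ 0 ∧
      X i * r ∈ J.map (MvPolynomial.map θ) ⊔ Ideal.span (Set.range fun a => lf n E (w a))) :
    h ≤ Module.finrank F (linPart J) := by
  classical
  let b := Module.finBasis F (linPart J)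
  let s : Fin (Module.finrank F (linPart J)) ⊕ Fin t → (Fin (n + 1) → E) :=
    Sum.elim (fun a => ev n θ (b a)) w
  have hU : Submodule.span E (ev n θ '' linPart J) ≤ Submodule.span E (Set.range s) := by
    refine Submodule.span_le.mpr ?_
    rintro _ ⟨v, hv, rfl⟩
    have h1 : ev n θ v = ∑ a, θ (b.repr ⟨v, hv⟩ a) • ev n θ (b a) := by
      have h2 := b.sum_repr ⟨v, hv⟩
      have h3 := congrArg Subtype.val h2
      ext i
      have h4 := congrFun h3 i
      simp only [Submodule.coe_sum, Finset.sum_apply] at h4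
      simp only [ev, Finset.sum_apply, Pi.smul_apply, smul_eq_mul]
      conv_lhs => rw [← h4]
      simp
    rw [h1]
    exact Submodule.sum_mem _ fun a _ => Submodule.smul_mem _ _
      (Submodule.subset_span ⟨Sum.inl a, rfl⟩)
  have hW : Submodule.span E (Set.range w) ≤ Submodule.span E (Set.range s) := by
    refine Submodule.span_mono ?_
    rintro _ ⟨a, rfl⟩
    exact ⟨Sum.inr a, rfl⟩
  have htop : Submodule.span E (Set.range s) = ⊤ := by
    rw [eq_top_iff, ← (Pi.basisFun E (Fin (n + 1))).span_eq]
    refine Submodule.span_le.mpr ?_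
    rintro _ ⟨i, rfl⟩
    obtain ⟨r, hr, hX⟩ := hw i
    obtain ⟨a, ha, c, hc, hac⟩ := Submodule.mem_sup.mp hX
    have h1 : cv n E (X i * r) = coeff 0 r • Pi.single i 1 := by
      rw [cv_mul, ← lf_single, cv_lf, coeff_zero_lf, zero_smul, add_zero]
    have h2 : cv n E (X i * r) ∈ Submodule.span E (Set.range s) := by
      rw [← hac, map_add]
      exact Submodule.add_mem _ (hU (cv_map_mem θ hJ hJm ha).2) (hW (cv_span_lf w hc))
    rw [h1] at h2
    have h3 := Submodule.smul_mem _ (coeff 0 r)⁻¹ h2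
    rw [smul_smul, inv_mul_cancel₀ hr, one_smul] at h3
    simpa using h3
  have := finrank_range_le_card (R := E) s
  rw [Set.finrank, htop, finrank_top] at this
  simp at this
  omega

end Stmt19

namespace Stmt19

lemma lf_map {n : ℕ} {F : Type*} [Field F] (A : (Fin (n + 1) → F) →ₗ[F] (Fin (n + 1) → F))
    (v : Fin (n + 1) → F) :
    aeval (fun i => lf n F (A (Pi.single i 1))) (lf n F v) = lf n F (A v) := by
  have h : (aeval (R := F) (fun i => lf n F (A (Pi.single i 1)))).toLinearMap ∘ₗ lf n F =
      lf n F ∘ₗ A := by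
    refine LinearMap.pi_ext' fun i => LinearMap.ext_ring ?_
    simp [lf_single]
  exact LinearMap.congr_fun h v

lemma lf_mem_span {n : ℕ} {F : Type*} [Field F] {ι : Type*} (ℓ : ι → (Fin (n + 1) → F))
    {v : Fin (n + 1) → F} (hv : v ∈ Submodule.span F (Set.range ℓ)) :
    lf n F v ∈ Ideal.span (Set.range fun a => lf n F (ℓ a)) := by
  have : Submodule.span F (Set.range ℓ) ≤
      linPart (Ideal.span (Set.range fun a => lf n F (ℓ a))) := by
    refine Submodule.span_le.mpr ?_
    rintro _ ⟨a, rfl⟩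
    exact Ideal.subset_span ⟨a, rfl⟩
  exact this hv

lemma span_lf_prime {n : ℕ} {F : Type*} [Field F] {ι : Type*} (ℓ : ι → (Fin (n + 1) → F)) :
    (Ideal.span (Set.range fun a => lf n F (ℓ a))).IsPrime := by
  set Q := Ideal.span (Set.range fun a => lf n F (ℓ a)) with hQ
  let W := Submodule.span F (Set.range ℓ)
  obtain ⟨f, hf⟩ := LinearMap.exists_leftInverse_of_injective W.subtype
    (Submodule.ker_subtype W)
  let A : (Fin (n + 1) → F) →ₗ[F] (Fin (n + 1) → F) := LinearMap.id - W.subtype ∘ₗ f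
  let π : MvPolynomial (Fin (n + 1)) F →ₐ[F] MvPolynomial (Fin (n + 1)) F :=
    aeval (fun i => lf n F (A (Pi.single i 1)))
  have hker : Q = RingHom.ker π := by
    apply le_antisymm
    · refine Ideal.span_le.mpr ?_
      rintro _ ⟨a, rfl⟩
      rw [SetLike.mem_coe, RingHom.mem_ker]
      change π (lf n F (ℓ a)) = 0
      rw [lf_map]
      have h1 : ℓ a ∈ W := Submodule.subset_span ⟨a, rfl⟩
      have h2 : f (ℓ a) = ⟨ℓ a, h1⟩ := LinearMap.congr_fun hf ⟨ℓ a, h1⟩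
      have h3 : A (ℓ a) = 0 := by simp [A, h2]
      rw [h3, map_zero]
    · intro g hg
      have h1 : (Ideal.Quotient.mkₐ F Q).comp π = Ideal.Quotient.mkₐ F Q := by
        refine MvPolynomial.algHom_ext fun i => ?_
        simp only [AlgHom.comp_apply, π, aeval_X, Ideal.Quotient.mkₐ_eq_mk]
        rw [Ideal.Quotient.eq, ← lf_single, ← map_sub]
        apply lf_mem_span
        have : A (Pi.single i 1) - Pi.single i 1 = - (f (Pi.single i 1) : Fin (n + 1) → F) := by
          simp [A]
        rw [this]
        exact Submodule.neg_mem _ (f _).2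
      have h2 := AlgHom.congr_fun h1 g
      rw [AlgHom.comp_apply, (RingHom.mem_ker).mp hg, map_zero] at h2
      exact Ideal.Quotient.eq_zero_iff_mem.mp h2.symm
  rw [hker]
  exact RingHom.ker_isPrime _

lemma span_lf_height {n : ℕ} {F : Type*} [Field F] (h : ℕ) :
    ∀ ℓ : Fin h → (Fin (n + 1) → F), LinearIndependent F ℓ →
    (h : ℕ∞) ≤ (Ideal.span (Set.range fun a => lf n F (ℓ a))).height := by
  induction h with
  | zero => intro ℓ _; simp
  | succ h ih =>
    intro ℓ hℓ
    obtain ⟨h1, h2⟩ := linearIndependent_finSucc.mp hℓ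
    have h3 := ih (Fin.tail ℓ) h1
    have := span_lf_prime (Fin.tail ℓ)
    have := span_lf_prime ℓ
    push_cast
    refine (add_le_add_left h3 1).trans (height_succ_le ?_)
    refine lt_of_le_of_ne (Ideal.span_mono ?_) ?_
    · rintro _ ⟨a, rfl⟩
      exact ⟨a.succ, rfl⟩
    · intro heq
      have h4 : lf n F (ℓ 0) ∈ Ideal.span (Set.range fun a => lf n F (Fin.tail ℓ a)) := by
        rw [heq]; exact Ideal.subset_span ⟨0, rfl⟩
      have h5 := cv_span_lf _ h4
      rw [cv_lf] at h5
      exact h2 h5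

lemma map_frobPow {R R' : Type*} [CommRing R] [CommRing R'] (θ : R →+* R') (q : ℕ) (A : Ideal R) :
    (frobPow q A).map θ ≤ frobPow q (A.map θ) := by
  unfold frobPow
  rw [Ideal.map_span]
  refine Ideal.span_mono ?_
  rintro _ ⟨_, ⟨x, hx, rfl⟩, rfl⟩
  exact ⟨θ x, Ideal.mem_map_of_mem _ hx, by simp⟩

lemma map_mul_mem {R R' : Type*} [CommRing R] [CommRing R'] (θ : R →+* R') (q : ℕ) {A : Ideal R}
    {f : R} (hf : ∀ g ∈ A, f * g ∈ frobPow q A) (g : R') (hg : g ∈ A.map θ) :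
    θ f * g ∈ frobPow q (A.map θ) := by
  have : A.map θ ≤ col (frobPow q (A.map θ)) (θ f) := by
    rw [Ideal.map_le_iff_le_comap]
    intro x hx
    rw [Ideal.mem_comap, mem_col, ← map_mul]
    exact map_frobPow θ q A (Ideal.mem_map_of_mem _ (hf x hx))
  exact this hg

lemma exists_form {n d : ℕ} {F : Type*} [Field F] {p : ℕ} (e : ℕ)
    {S : Set (MvPolynomial (Fin (n + 1)) F)} (hS : ∀ f ∈ S, f.IsHomogeneous d) (N : ℕ)
    (hsur : Ideal.span {y | ∃ (φ : MvPolynomial (Fin (n + 1)) F →+ MvPolynomial (Fin (n + 1)) F)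
      (a : MvPolynomial (Fin (n + 1)) F),
      (∀ r x, φ (r ^ p ^ e * x) = r * φ x) ∧ a ∈ Ideal.span S ^ N ∧ y = φ a} = ⊤) :
    ∃ f ∈ Ideal.span S ^ N, f.IsHomogeneous (d * N) ∧ f ∉ frobPow (p ^ e) (maxIdl n F) := by
  obtain ⟨T, hT, hST⟩ := pow_span_homog hS N
  by_contra! hcon
  have hle : Ideal.span S ^ N ≤ frobPow (p ^ e) (maxIdl n F) := by
    rw [hST]
    refine Ideal.span_le.mpr fun f hf => ?_
    exact hcon f (by rw [hST]; exact Ideal.subset_span hf) (hT f hf)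
  have hne : maxIdl n F ≠ ⊤ := maxIdl_prime.ne_top
  apply hne
  rw [eq_top_iff, ← hsur]
  refine Ideal.span_le.mpr ?_
  rintro _ ⟨φ, a, hφ, ha, rfl⟩
  exact qlin_mem hφ (hle ha)

lemma HomId.le_max {n : ℕ} {F : Type*} [Field F] {J : Ideal (MvPolynomial (Fin (n + 1)) F)}
    (hJ : HomId J) (hne : J ≠ ⊤) : J ≤ maxIdl n F := by
  intro g hg
  rw [mem_maxIdl]
  by_contra h0
  have h1 := hJ.comp_mem hg 0
  rw [homogeneousComponent_zero] at h1
  apply hne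
  refine Ideal.eq_top_of_isUnit_mem _ h1 ?_
  exact (IsUnit.mk0 _ h0).map C

lemma idealHeight_spec {R : Type*} [CommRing R] {J : Ideal R} {h : ℕ}
    (hh : idealHeight J = (h : ℕ∞)) :
    (∃ P : Ideal R, P.IsPrime ∧ J ≤ P ∧ P.height = h) ∧
      ∀ P : Ideal R, P.IsPrime → J ≤ P → (h : ℕ∞) ≤ P.height := by
  unfold idealHeight at hh
  constructor
  · obtain ⟨⟨P, hP⟩, -⟩ := ENat.iInf_eq_natCast_iff.mp hh
    obtain ⟨⟨hJP, hht⟩, -⟩ := ENat.iInf_eq_natCast_iff.mp hP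
    exact ⟨P.asIdeal, P.2, hJP, (PrimeSpectrum.height_eq_orderHeight P).trans hht⟩
  · intro P hP hJP
    rw [← hh]
    have := PrimeSpectrum.height_eq_orderHeight (⟨P, hP⟩ : PrimeSpectrum R)
    simp only at this
    rw [this]
    exact iInf₂_le (⟨P, hP⟩ : PrimeSpectrum R) hJP

lemma main {n d h : ℕ} {F : Type*} [Field F] {p : ℕ} (hp : p.Prime) [CharP F p]
    (S : Set (MvPolynomial (Fin (n + 1)) F))
    (hhom : ∀ f ∈ S, f.IsHomogeneous d) (hd : 0 < d) (c : ℝ)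
    (hSFP : SharplyFPurePair p (Ideal.span S) c)
    (hh : idealHeight (testIdeal p c (Ideal.span S)) = (h : ℕ∞))
    (hc : c = (h : ℝ) / d) :
    ∃ ℓ : Fin h → (Fin (n + 1) → F),
      testIdeal p c (Ideal.span S) = Ideal.span (Set.range fun a => lf n F (ℓ a)) := by
  have hJ : HomId (_root_.testIdeal p c (Ideal.span S)) := HomId.testIdeal hp hhom c
  have hcompat := fun (e : ℕ) (f : MvPolynomial (Fin (n + 1)) F)
    (hf : f ∈ Ideal.span S ^ ⌈c * ((p : ℝ) ^ e - 1)⌉₊) g hg =>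
    test_compat hp (Ideal.span S) c e hf (g := g) hg
  obtain ⟨⟨P, hP, hJP, hPh⟩, hmin⟩ := idealHeight_spec hh
  set J := _root_.testIdeal p c (Ideal.span S) with hJdef
  have hJne : J ≠ ⊤ := fun h => hP.ne_top (top_le_iff.mp (h ▸ hJP))
  have hJm := hJ.le_max hJne
  have hhn : h ≤ n + 1 := by
    have := (hmin _ maxIdl_prime hJm).trans maxIdl_height
    exact_mod_cast this
  obtain ⟨t, hht⟩ : ∃ t, h + t = n + 1 := ⟨n + 1 - h, by omega⟩
  let E := AlgebraicClosure F
  let θ : MvPolynomial (Fin (n + 1)) F →+* MvPolynomial (Fin (n + 1)) E :=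
    MvPolynomial.map (algebraMap F E)
  have : CharP E p := charP_of_injective_algebraMap (algebraMap F E).injective p
  have hinf : Infinite E := IsAlgClosed.instInfinite
  obtain ⟨w, hw⟩ := key (d := d) hp hht (hJ.map (algebraMap F E))
    (by
      intro P' hP' hJP'
      refine le_trans ?_ (height_comap_le (F := F) P')
      exact hmin _ inferInstance (Ideal.map_le_iff_le_comap.mp hJP'))
    (by
      intro M
      obtain ⟨e, heM, he0, hsur⟩ := (Filter.frequently_atTop.mp hSFP) M
      obtain ⟨f, hfI, hfD, hfm⟩ := exists_form e hhom _ hsur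
      refine ⟨e, heM.trans (Nat.lt_pow_self hp.one_lt).le, θ f, _, hfD.map _, ?_, ?_, ?_⟩
      · intro hmem
        obtain ⟨u, hu, huq⟩ := exists_monomial hfm
        have h1 := coeff_zero_of_mem hp e hmem u huq
        rw [coeff_map] at h1
        exact hu ((map_eq_zero _).mp h1)
      · have hq : 1 ≤ p ^ e := Nat.one_le_pow _ _ hp.pos
        have hd' : (0 : ℝ) < d := by exact_mod_cast hd
        have hq' : (0 : ℝ) ≤ (p : ℝ) ^ e - 1 := by
          have : (1 : ℝ) ≤ (p : ℝ) ^ e := by exact_mod_cast hq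
          linarith
        have hc0 : 0 ≤ c := by rw [hc]; positivity
        have h1 := (Nat.ceil_lt_add_one (mul_nonneg hc0 hq')).le
        have h2 := mul_le_mul_of_nonneg_left h1 hd'.le
        have h3 : (d : ℝ) * (c * ((p : ℝ) ^ e - 1) + 1) = h * ((p : ℝ) ^ e - 1) + d := by
          rw [hc]; field_simp
        rw [h3] at h2
        have h4 : ((p ^ e - 1 : ℕ) : ℝ) = (p : ℝ) ^ e - 1 := by
          rw [Nat.cast_sub hq]; simp
        rw [← h4] at h2
        rw [← h4]
        exact_mod_cast h2
      · exact map_mul_mem θ _ (hcompat e f hfI))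
  have hfr := finrank_linPart (algebraMap F E) hht hJ hJm w hw
  let b := Module.finBasis F (linPart J)
  let ℓ : Fin h → (Fin (n + 1) → F) := fun a => (b (Fin.castLE hfr a) : Fin (n + 1) → F)
  have hli : LinearIndependent F ℓ := by
    have h1 := b.linearIndependent.map' (linPart J).subtype (Submodule.ker_subtype _)
    exact h1.comp _ (Fin.castLE_injective hfr)
  refine ⟨ℓ, ?_⟩
  have hQ := span_lf_prime ℓ
  have hQh := span_lf_height h ℓ hli
  have hQJ : Ideal.span (Set.range fun a => lf n F (ℓ a)) ≤ J := by
    refine Ideal.span_le.mpr ?_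
    rintro _ ⟨a, rfl⟩
    exact (b (Fin.castLE hfr a)).2
  refine le_antisymm ?_ hQJ
  refine hJP.trans (le_of_eq ?_)
  by_contra hne
  have hlt := lt_of_le_of_ne (hQJ.trans hJP) (Ne.symm hne)
  have h1 := (add_le_add_left hQh 1).trans (height_succ_le hlt)
  rw [hPh] at h1
  norm_cast at h1
  omega

end Stmt19

/-- If `(R, I^c)` is sharply `F`-pure at `c = fpt(I)` and `c = h/d` where
`h = height τ(R, I^c)`, then `τ(R, I^c)` is a prime ideal generated by `h` linear forms. -/
theorem stmt19 {n d h : ℕ} {p : ℕ} (hp : p.Prime) [CharP k p]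
    (I : Ideal (MvPolynomial (Fin (n + 1)) k))
    (S : Set (MvPolynomial (Fin (n + 1)) k)) (hgen : I = Ideal.span S)
    (hhom : ∀ f ∈ S, f.IsHomogeneous d) (hd : 0 < d) (c : ℝ)
    (hfpt : Tendsto (fun e : ℕ => (nuFn I (p ^ e) : ℝ) / (p : ℝ) ^ e) atTop (nhds c))
    (hSFP : SharplyFPurePair p I c)
    (hh : idealHeight (testIdeal p c I) = (h : ℕ∞))
    (hc : c = (h : ℝ) / d) :
    (∃ ℓ : Fin h → MvPolynomial (Fin (n + 1)) k,
      (∀ i, (ℓ i).IsHomogeneous 1) ∧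
      testIdeal p c I = Ideal.span (Set.range ℓ)) ∧
    (testIdeal p c I).IsPrime := by
  subst hgen
  obtain ⟨ℓ, hℓ⟩ := Stmt19.main hp S hhom hd c hSFP hh hc
  refine ⟨⟨fun i => Stmt19.lf n k (ℓ i), fun i => Stmt19.lf_homog _, hℓ⟩, ?_⟩
  rw [hℓ]
  exact Stmt19.span_lf_prime ℓ
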